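/- arXiv:1801.08608 — 2 statements merged into one kernel-verified Lean document; each statement's English description precedes it below -/
import Mathlib

section
/- Let 𝒜 be a d-algebra with a multiplicative unit e. If φ ∈ 𝒜 is a totally finite element and a ∈ 𝒜 is arbitrary, then the products a·φ and φ·a are totally finite elements of 𝒜. In particular, the set Φ₂(𝒜) of totally finite elements is a ring ideal of 𝒜. -/
namespace FiniteElementsPaper

/-- Product of `p` factors `φ 0 * φ 1 * ⋯ * φ (p-1)` in a (possibly non-unital)
multiplicative structure; junk value `0` when `p = 0`. -/
def mulProd {A : Type*} [Mul A] [Zero A] : (p : ℕ) → (Fin p → A) → A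
  | 0, _ => 0
  | q + 1, φ => Fin.foldl q (fun acc i => acc * φ i.succ) (φ 0)

/-- `p`-th power `a^p` (junk value `0` for `p = 0`). -/
def mpow {A : Type*} [Mul A] [Zero A] (a : A) (p : ℕ) : A :=
  mulProd p (fun _ => a)

/-- The set `Π_p(𝒜)` of all `p`-fold products. -/
def piSet (A : Type*) [Mul A] [Zero A] (p : ℕ) : Set A :=
  {x | ∃ φ : Fin p → A, x = mulProd p φ}

variable {A : Type*} [Lattice A] [AddCommGroup A] [Module ℝ A]

/-- `z` is a majorant of `φ`: `z ≥ 0` and for every `x` there is `c > 0` with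
`|x| ⊓ n • |φ| ≤ c • z` for all `n`. -/
def IsMajorant (z φ : A) : Prop :=
  0 ≤ z ∧ ∀ x : A, ∃ c : ℝ, 0 < c ∧ ∀ n : ℕ, |x| ⊓ n • |φ| ≤ c • z

/-- `φ` is a finite element. -/
def IsFiniteElt (φ : A) : Prop := ∃ z : A, IsMajorant z φ

/-- `φ` is a totally finite element: it has a majorant which is itself finite. -/
def IsTotallyFiniteElt (φ : A) : Prop := ∃ z : A, IsMajorant z φ ∧ IsFiniteElt z

/-- `φ` is self-majorizing: `|φ|` is a majorant of `φ`. -/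
def IsSelfMajorizing (φ : A) : Prop := IsMajorant |φ| φ

/-- `φ ∈ Φ₃(A) = S₊(A) - S₊(A)`. -/
def InPhi3 (φ : A) : Prop :=
  ∃ s t : A, 0 ≤ s ∧ 0 ≤ t ∧ IsSelfMajorizing s ∧ IsSelfMajorizing t ∧ φ = s - t

/-- `w` is a majorant of `φ` relative to the subset `S` (all lattice operations
computed in the ambient algebra). -/
def IsMajorantIn (S : Set A) (w φ : A) : Prop :=
  0 ≤ w ∧ ∀ x ∈ S, ∃ c : ℝ, 0 < c ∧ ∀ n : ℕ, |x| ⊓ n • |φ| ≤ c • w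

/-- `φ` is a finite element of the sublattice `S` (majorant required to lie in `S`). -/
def IsFiniteEltIn (S : Set A) (φ : A) : Prop := ∃ w ∈ S, IsMajorantIn S w φ

/-- `φ` is a totally finite element of the sublattice `S`. -/
def IsTotallyFiniteEltIn (S : Set A) (φ : A) : Prop :=
  ∃ w ∈ S, IsMajorantIn S w φ ∧ IsFiniteEltIn S w

/-- `φ` is self-majorizing in the sublattice `S`. -/
def IsSelfMajorizingIn (S : Set A) (φ : A) : Prop := IsMajorantIn S |φ| φ

/-- `φ ∈ Φ₃(S) = S₊(S) - S₊(S)` for the sublattice `S`. -/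
def InPhi3In (S : Set A) (φ : A) : Prop :=
  ∃ s t : A, s ∈ S ∧ t ∈ S ∧ 0 ≤ s ∧ 0 ≤ t ∧
    IsSelfMajorizingIn S s ∧ IsSelfMajorizingIn S t ∧ φ = s - t

variable (A) in
/-- Archimedean ℓ-algebra structure: an Archimedean vector lattice together with an
associative bilinear multiplication whose product of positive elements is positive. -/
structure IsLAlgebra [Mul A] : Prop where
  add_le_add_left : ∀ a b : A, a ≤ b → ∀ c : A, c + a ≤ c + b
  smul_le_smul : ∀ (r : ℝ) (a b : A), 0 ≤ r → a ≤ b → r • a ≤ r • b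
  archimedean : ∀ a b : A, 0 ≤ a → (∀ n : ℕ, n • a ≤ b) → a = 0
  mul_assoc : ∀ a b c : A, a * b * c = a * (b * c)
  left_distrib : ∀ a b c : A, a * (b + c) = a * b + a * c
  right_distrib : ∀ a b c : A, (a + b) * c = a * c + b * c
  smul_mul : ∀ (r : ℝ) (a b : A), (r • a) * b = r • (a * b)
  mul_smul : ∀ (r : ℝ) (a b : A), a * (r • b) = r • (a * b)
  mul_nonneg : ∀ a b : A, 0 ≤ a → 0 ≤ b → 0 ≤ a * b

variable (A) in
/-- A `d`-algebra: ℓ-algebra in which `a ⊓ b = 0` implies `(a*c) ⊓ (b*c) = (c*a) ⊓ (c*b) = 0`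
for all `c ≥ 0`. -/
structure IsDAlgebra [Mul A] extends IsLAlgebra A : Prop where
  d_prop : ∀ a b c : A, a ⊓ b = 0 → 0 ≤ c → (a * c) ⊓ (b * c) = 0 ∧ (c * a) ⊓ (c * b) = 0

variable (A) in
/-- An `f`-algebra: ℓ-algebra in which `a ⊓ b = 0` implies `(a*c) ⊓ b = (c*a) ⊓ b = 0`
for all `c ≥ 0`. -/
structure IsFAlgebra [Mul A] extends IsLAlgebra A : Prop where
  f_prop : ∀ a b c : A, a ⊓ b = 0 → 0 ≤ c → (a * c) ⊓ b = 0 ∧ (c * a) ⊓ b = 0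

/-- `e` is a multiplicative unit. -/
def IsMulUnit [Mul A] (e : A) : Prop := ∀ a : A, a * e = a ∧ e * a = a

/-- `e` is an order unit. -/
def IsOrderUnit (e : A) : Prop := 0 ≤ e ∧ ∀ x : A, ∃ l : ℝ, 0 ≤ l ∧ |x| ≤ l • e

variable (A) in
/-- The algebra is semiprime: `0` is its only nilpotent element. -/
def IsSemiprime [Mul A] [Zero A] : Prop :=
  ∀ (a : A) (n : ℕ), 0 < n → mpow a n = 0 → a = 0

variable (A) in
/-- The vector lattice is uniformly complete. -/
def UniformlyComplete : Prop :=
  ∀ u : A, 0 ≤ u → ∀ f : ℕ → A,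
    (∀ ε : ℝ, 0 < ε → ∃ K : ℕ, ∀ m n : ℕ, K ≤ m → K ≤ n → |f m - f n| ≤ ε • u) →
    ∃ a : A, ∀ ε : ℝ, 0 < ε → ∃ K : ℕ, ∀ n : ℕ, K ≤ n → |f n - a| ≤ ε • u

variable (A) in
/-- The weak factorization property: every element is dominated by a product. -/
def WeakFactorization [Mul A] : Prop := ∀ a : A, ∃ b c : A, a ≤ b * c


theorem IsLAlgebra.isOrderedAddMonoid [Mul A] (hA : IsLAlgebra A) : IsOrderedAddMonoid A where
  add_le_add_left a b h c := by
    simpa only [add_comm] using hA.add_le_add_left a b h c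

/-- In a lattice-ordered group, the infimum is subadditive on the positive cone. -/
theorem inf_add_le_of_nonneg {G : Type*} [Lattice G] [AddCommGroup G]
    [IsOrderedAddMonoid G] {x a b : G}
    (hx : 0 ≤ x) (ha : 0 ≤ a) (hb : 0 ≤ b) : x ⊓ (a + b) ≤ x ⊓ a + x ⊓ b := by
  rw [add_inf, inf_add, inf_add]
  refine le_inf (le_inf ?_ ?_) (le_inf ?_ inf_le_right)
  · exact inf_le_left.trans (le_add_of_nonneg_right hx)
  · exact inf_le_left.trans (le_add_of_nonneg_left ha)
  · exact inf_le_left.trans (le_add_of_nonneg_right hb)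

theorem IsMajorant.add [Mul A] (hA : IsLAlgebra A) {z w φ ψ : A}
    (hz : IsMajorant z φ) (hw : IsMajorant w ψ) : IsMajorant (z + w) (φ + ψ) := by
  have := hA.isOrderedAddMonoid
  refine ⟨add_nonneg hz.1 hw.1, fun x => ?_⟩
  obtain ⟨c, hc, hcz⟩ := hz.2 x
  obtain ⟨d, hd, hdw⟩ := hw.2 x
  refine ⟨c + d, add_pos hc hd, fun n => ?_⟩
  have hdz : 0 ≤ d • z := by simpa using hA.smul_le_smul d 0 z hd.le hz.1
  have hcw : 0 ≤ c • w := by simpa using hA.smul_le_smul c 0 w hc.le hw.1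
  calc |x| ⊓ n • |φ + ψ| ≤ |x| ⊓ (n • |φ| + n • |ψ|) := by
        rw [← nsmul_add]
        exact inf_le_inf_left _ (nsmul_le_nsmul_right (abs_add_le φ ψ) n)
    _ ≤ |x| ⊓ n • |φ| + |x| ⊓ n • |ψ| :=
        inf_add_le_of_nonneg (abs_nonneg x) (nsmul_nonneg (abs_nonneg φ) n)
          (nsmul_nonneg (abs_nonneg ψ) n)
    _ ≤ c • z + d • w := add_le_add (hcz n) (hdw n)
    _ ≤ c • z + d • w + (d • z + c • w) := le_add_of_nonneg_right (add_nonneg hdz hcw)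
    _ = (c + d) • (z + w) := by module

/-- An element all of whose multiples are approximated, relatively uniformly, by multiples
of `|φ|` has the same majorants as `φ`. -/
theorem IsMajorant.of_approx [Mul A] (hA : IsLAlgebra A) {z φ ψ : A} (hz : IsMajorant z φ)
    (h : ∀ n : ℕ, ∃ q : A, 0 ≤ q ∧
      ∀ k : ℕ, 0 < k → n • |ψ| ≤ k • |φ| + (k : ℝ)⁻¹ • q) : IsMajorant z ψ := by
  have := hA.isOrderedAddMonoid
  refine ⟨hz.1, fun x => ?_⟩
  obtain ⟨c, hc, hcz⟩ := hz.2 x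
  refine ⟨c, hc, fun n => ?_⟩
  obtain ⟨q, hq, hqk⟩ := h n
  set t := |x| ⊓ n • |ψ|
  have key : ∀ k : ℕ, k • ((t - c • z) ⊔ 0) ≤ q := by
    intro k
    rcases Nat.eq_zero_or_pos k with rfl | hk
    · simpa using hq
    have hk' : (0 : ℝ) < k := Nat.cast_pos.mpr hk
    have hq' : 0 ≤ (k : ℝ)⁻¹ • q := by
      simpa using hA.smul_le_smul (k : ℝ)⁻¹ 0 q (inv_nonneg.mpr hk'.le) hq
    have ht : t ≤ c • z + (k : ℝ)⁻¹ • q :=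
      calc t ≤ |x| ⊓ (k • |φ| + (k : ℝ)⁻¹ • q) := inf_le_inf_left _ (hqk k hk)
        _ ≤ |x| ⊓ k • |φ| + |x| ⊓ (k : ℝ)⁻¹ • q :=
          inf_add_le_of_nonneg (abs_nonneg x) (nsmul_nonneg (abs_nonneg φ) k) hq'
        _ ≤ c • z + (k : ℝ)⁻¹ • q := add_le_add (hcz k) inf_le_right
    have hs := hA.smul_le_smul k _ _ hk'.le (sup_le (sub_le_iff_le_add'.mpr ht) hq')
    rwa [smul_inv_smul₀ hk'.ne', Nat.cast_smul_eq_nsmul] at hs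
  have h0 := hA.archimedean _ q le_sup_right key
  exact sub_nonpos.mp (h0 ▸ le_sup_left)

section Multiplication

variable [Mul A]

theorem IsLAlgebra.neg_mul (hA : IsLAlgebra A) (a b : A) : -a * b = -(a * b) := by
  simpa using hA.smul_mul (-1) a b

theorem IsLAlgebra.mul_neg (hA : IsLAlgebra A) (a b : A) : a * -b = -(a * b) := by
  simpa using hA.mul_smul (-1) a b

theorem IsLAlgebra.sub_mul (hA : IsLAlgebra A) (a b c : A) : (a - b) * c = a * c - b * c := by
  rw [sub_eq_add_neg, hA.right_distrib, hA.neg_mul, ← sub_eq_add_neg]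

theorem IsLAlgebra.mul_sub (hA : IsLAlgebra A) (a b c : A) : a * (b - c) = a * b - a * c := by
  rw [sub_eq_add_neg, hA.left_distrib, hA.mul_neg, ← sub_eq_add_neg]

theorem IsLAlgebra.mul_le_mul_right (hA : IsLAlgebra A) {a b c : A} (h : a ≤ b) (hc : 0 ≤ c) :
    a * c ≤ b * c := by
  have := hA.isOrderedAddMonoid
  rw [← sub_nonneg, ← hA.sub_mul]
  exact hA.mul_nonneg _ _ (sub_nonneg.mpr h) hc

theorem IsLAlgebra.mul_le_mul_left (hA : IsLAlgebra A) {a b c : A} (h : a ≤ b) (hc : 0 ≤ c) :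
    c * a ≤ c * b := by
  have := hA.isOrderedAddMonoid
  rw [← sub_nonneg, ← hA.mul_sub]
  exact hA.mul_nonneg _ _ hc (sub_nonneg.mpr h)

theorem IsLAlgebra.abs_mul_le (hA : IsLAlgebra A) (a b : A) : |a * b| ≤ |a| * |b| := by
  have := hA.isOrderedAddMonoid
  have hp := posPart_nonneg a
  have hq := negPart_nonneg a
  have hp' := posPart_nonneg b
  have hq' := negPart_nonneg b
  have h1 := hA.mul_nonneg _ _ hp hp'
  have h2 := hA.mul_nonneg _ _ hp hq'
  have h3 := hA.mul_nonneg _ _ hq hp'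
  have h4 := hA.mul_nonneg _ _ hq hq'
  have hab : a * b = a⁺ * b⁺ - a⁻ * b⁺ - (a⁺ * b⁻ - a⁻ * b⁻) := by
    conv_lhs => rw [← posPart_sub_negPart a, ← posPart_sub_negPart b]
    rw [hA.mul_sub, hA.sub_mul, hA.sub_mul]
  have habs : |a| * |b| = a⁺ * b⁺ + a⁻ * b⁺ + (a⁺ * b⁻ + a⁻ * b⁻) := by
    rw [← posPart_add_negPart a, ← posPart_add_negPart b, hA.left_distrib, hA.right_distrib,
      hA.right_distrib]
  rw [habs, hab]
  refine abs_le'.mpr ⟨?_, ?_⟩ <;> rw [← sub_nonneg]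
  · convert add_nonneg (add_nonneg h3 h3) (add_nonneg h2 h2) using 1
    abel
  · convert add_nonneg (add_nonneg h1 h1) (add_nonneg h4 h4) using 1
    abel

theorem IsDAlgebra.unit_nonneg (hA : IsDAlgebra A) {e : A} (hunit : IsMulUnit e) : 0 ≤ e := by
  have := hA.isOrderedAddMonoid
  have hp := posPart_nonneg e
  have hq := negPart_nonneg e
  have hd : e⁺ ⊓ e⁻ = 0 := posPart_inf_negPart_eq_zero e
  have hpq := (hA.d_prop _ _ _ hd hp).2
  have hqq := (hA.d_prop _ _ _ hd hq).1
  have he1 : e⁺ * e⁻ - e⁻ * e⁻ = e⁻ := by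
    rw [← hA.sub_mul, posPart_sub_negPart, (hunit _).2]
  have he2 : e⁺ * e⁺ - e⁺ * e⁻ = e⁺ := by
    rw [← hA.mul_sub, posPart_sub_negPart, (hunit _).1]
  have hzero : e⁻ * e⁻ = 0 := by
    rwa [inf_eq_right.mpr (sub_nonneg.mp (he1.symm ▸ hq))] at hqq
  rw [hzero, sub_zero] at he1
  rw [he1] at hpq he2
  have hle : e⁻ ≤ e⁺ * e⁺ := sub_nonneg.mp (he2.symm ▸ hp)
  rw [inf_eq_right.mpr hle] at hpq
  exact negPart_eq_zero.mp hpq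

/-- Disjoint elements of a unital `d`-algebra have zero product. -/
theorem IsDAlgebra.mul_eq_zero_of_inf_eq_zero (hA : IsDAlgebra A) {e : A} (hunit : IsMulUnit e)
    {p q : A} (h : p ⊓ q = 0) : p * q = 0 := by
  have := hA.isOrderedAddMonoid
  have he := hA.unit_nonneg hunit
  have hp : 0 ≤ p := h ▸ inf_le_left
  have hq : 0 ≤ q := h ▸ inf_le_right
  have hpq := hA.mul_nonneg _ _ hp hq
  have h1 : (p * q) ⊓ q = 0 := by
    refine le_antisymm ?_ (le_inf hpq hq)
    rw [← (hA.d_prop p q (q + e) h (add_nonneg hq he)).1]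
    refine inf_le_inf (hA.mul_le_mul_left (le_add_of_nonneg_right he) hp) ?_
    simpa only [(hunit q).1] using
      hA.mul_le_mul_left (le_add_of_nonneg_left hq : e ≤ q + e) hq
  refine le_antisymm ?_ hpq
  rw [← (hA.d_prop _ _ (p + e) h1 (add_nonneg hp he)).2]
  refine le_inf ?_ (hA.mul_le_mul_right (le_add_of_nonneg_right he) hq)
  simpa only [(hunit (p * q)).2] using
    hA.mul_le_mul_right (le_add_of_nonneg_left hp : e ≤ p + e) hpq

theorem IsDAlgebra.mul_self_nonneg (hA : IsDAlgebra A) {e : A} (hunit : IsMulUnit e) (u : A) :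
    0 ≤ u * u := by
  have := hA.isOrderedAddMonoid
  have hd : u⁺ ⊓ u⁻ = 0 := posPart_inf_negPart_eq_zero u
  have h1 := hA.mul_eq_zero_of_inf_eq_zero hunit hd
  have h2 := hA.mul_eq_zero_of_inf_eq_zero hunit (inf_comm u⁺ u⁻ ▸ hd)
  have hu : u * u = u⁺ * u⁺ + u⁻ * u⁻ := by
    conv_lhs => rw [← posPart_sub_negPart u]
    rw [hA.mul_sub, hA.sub_mul, hA.sub_mul, h1, h2]
    abel
  rw [hu]
  exact add_nonneg (hA.mul_nonneg _ _ (posPart_nonneg u) (posPart_nonneg u))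
    (hA.mul_nonneg _ _ (negPart_nonneg u) (negPart_nonneg u))

/-- Up to a relatively uniformly small error, a positive element is bounded by multiples of
the unit. -/
theorem IsDAlgebra.le_nsmul_unit_add (hA : IsDAlgebra A) {e : A} (hunit : IsMulUnit e)
    {d : A} (hd : 0 ≤ d) {k : ℕ} (hk : 0 < k) : d ≤ k • e + (k : ℝ)⁻¹ • (d * d) := by
  have := hA.isOrderedAddMonoid
  have hk' : (0 : ℝ) < k := Nat.cast_pos.mpr hk
  have hsq := hA.mul_self_nonneg hunit (d - (k : ℝ) • e)
  have hexp : (d - (k : ℝ) • e) * (d - (k : ℝ) • e) =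
      d * d - (k : ℝ) • d - ((k : ℝ) • d - (k : ℝ) • (k : ℝ) • e) := by
    rw [hA.mul_sub, hA.sub_mul, hA.sub_mul, hA.mul_smul, hA.smul_mul, hA.smul_mul, hA.mul_smul,
      (hunit d).1, (hunit d).2, (hunit e).1]
  rw [hexp] at hsq
  have h := hA.smul_le_smul (k : ℝ)⁻¹ _ _ (inv_nonneg.mpr hk'.le) hsq
  have hcalc : (k : ℝ)⁻¹ • (d * d - (k : ℝ) • d - ((k : ℝ) • d - (k : ℝ) • (k : ℝ) • e)) + d =
      (k : ℝ) • e + (k : ℝ)⁻¹ • (d * d) - d := by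
    simp only [smul_sub, inv_smul_smul₀ hk'.ne']
    abel
  rw [smul_zero] at h
  rw [← sub_nonneg, ← Nat.cast_smul_eq_nsmul ℝ k e, ← hcalc]
  exact add_nonneg h hd

theorem IsMajorant.mul_left (hA : IsDAlgebra A) {e : A} (hunit : IsMulUnit e) {z φ : A}
    (hz : IsMajorant z φ) (a : A) : IsMajorant z (a * φ) := by
  have := hA.isOrderedAddMonoid
  refine hz.of_approx hA.toIsLAlgebra fun n => ?_
  have hd : 0 ≤ n • |a| := nsmul_nonneg (abs_nonneg a) n
  refine ⟨n • |a| * (n • |a|) * |φ|,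
    hA.mul_nonneg _ _ (hA.mul_nonneg _ _ hd hd) (abs_nonneg φ), fun k hk => ?_⟩
  calc n • |a * φ| ≤ n • (|a| * |φ|) := nsmul_le_nsmul_right (hA.abs_mul_le a φ) n
    _ = n • |a| * |φ| := by
      rw [← Nat.cast_smul_eq_nsmul ℝ, ← Nat.cast_smul_eq_nsmul ℝ n |a|, hA.smul_mul]
    _ ≤ _ := hA.mul_le_mul_right (hA.le_nsmul_unit_add hunit hd hk) (abs_nonneg φ)
    _ = _ := by
      rw [hA.right_distrib, hA.smul_mul, ← Nat.cast_smul_eq_nsmul ℝ k e, hA.smul_mul,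
        (hunit _).2, Nat.cast_smul_eq_nsmul]

theorem IsMajorant.mul_right (hA : IsDAlgebra A) {e : A} (hunit : IsMulUnit e) {z φ : A}
    (hz : IsMajorant z φ) (a : A) : IsMajorant z (φ * a) := by
  have := hA.isOrderedAddMonoid
  refine hz.of_approx hA.toIsLAlgebra fun n => ?_
  have hd : 0 ≤ n • |a| := nsmul_nonneg (abs_nonneg a) n
  refine ⟨|φ| * (n • |a| * (n • |a|)),
    hA.mul_nonneg _ _ (abs_nonneg φ) (hA.mul_nonneg _ _ hd hd), fun k hk => ?_⟩
  calc n • |φ * a| ≤ n • (|φ| * |a|) := nsmul_le_nsmul_right (hA.abs_mul_le φ a) n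
    _ = |φ| * (n • |a|) := by
      rw [← Nat.cast_smul_eq_nsmul ℝ, ← Nat.cast_smul_eq_nsmul ℝ n |a|, hA.mul_smul]
    _ ≤ _ := hA.mul_le_mul_left (hA.le_nsmul_unit_add hunit hd hk) (abs_nonneg φ)
    _ = _ := by
      rw [hA.left_distrib, hA.mul_smul, ← Nat.cast_smul_eq_nsmul ℝ k e, hA.mul_smul,
        (hunit _).1, Nat.cast_smul_eq_nsmul]

end Multiplication

/-- In a d-algebra with a multiplicative unit, products of an arbitrary element
with a totally finite element are totally finite; in particular `Φ₂(𝒜)` is a ring ideal. -/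
theorem stmt2 {A : Type*} [Lattice A] [AddCommGroup A] [Module ℝ A] [Mul A]
    (hA : IsDAlgebra A) (e : A) (hunit : IsMulUnit e) :
    (∀ φ a : A, IsTotallyFiniteElt φ → IsTotallyFiniteElt (a * φ) ∧ IsTotallyFiniteElt (φ * a)) ∧
    (∀ x y : A, IsTotallyFiniteElt x → IsTotallyFiniteElt y → IsTotallyFiniteElt (x + y)) ∧
    (∀ x : A, IsTotallyFiniteElt x → IsTotallyFiniteElt (-x)) := by
  refine ⟨?_, ?_, ?_⟩
  · rintro φ a ⟨z, hz, hfin⟩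
    exact ⟨⟨z, hz.mul_left hA hunit a, hfin⟩, ⟨z, hz.mul_right hA hunit a, hfin⟩⟩
  · rintro x y ⟨z, hz, w, hw⟩ ⟨z', hz', w', hw'⟩
    exact ⟨z + z', hz.add hA.toIsLAlgebra hz', w + w', hw.add hA.toIsLAlgebra hw'⟩
  · rintro x ⟨z, hz, hfin⟩
    exact ⟨z, ⟨hz.1, by simpa only [abs_neg] using hz.2⟩, hfin⟩

end FiniteElementsPaper
end

section
/- Let 𝒜 be a uniformly complete f-algebra with the weak factorization property, let p ∈ ℕ with p ≥ 2, and let i ∈ {1, 2}. If φ₁, …, φ_p ∈ Φ_i(𝒜) are finite (respectively totally finite) elements with majorants u₁, …, u_p, then the product φ₁⋯φ_p belongs to Φ_i(𝒜) with majorant (u₁ ∨ … ∨ u_p)^p. In particular, Φ₁(𝒜) and Φ₂(𝒜) are closed under multiplication. -/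
namespace FiniteElementsPaper

variable {A : Type*} [Lattice A] [AddCommGroup A] [Module ℝ A]

section LatticeOrderedGroup

variable {G : Type*} [Lattice G] [AddCommGroup G] [IsOrderedAddMonoid G]

theorem inf_add_le_inf_add_inf {a b c : G} (ha : 0 ≤ a) (hb : 0 ≤ b) (hc : 0 ≤ c) :
    c ⊓ (a + b) ≤ c ⊓ a + c ⊓ b := by
  rw [add_inf, inf_add, inf_add]
  refine le_inf (le_inf ?_ ?_) (le_inf ?_ inf_le_right)
  · exact inf_le_left.trans (le_add_of_nonneg_right hc)
  · exact inf_le_left.trans (le_add_of_nonneg_left ha)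
  · exact inf_le_left.trans (le_add_of_nonneg_right hb)

theorem inf_sum_le_sum_inf {ι : Type*} (s : Finset ι) {f : ι → G} (hf : ∀ i, 0 ≤ f i)
    {c : G} (hc : 0 ≤ c) : c ⊓ ∑ i ∈ s, f i ≤ ∑ i ∈ s, c ⊓ f i := by
  classical
  induction s using Finset.induction_on with
  | empty => simp
  | insert a s ha ih =>
    rw [Finset.sum_insert ha, Finset.sum_insert ha]
    exact (inf_add_le_inf_add_inf (hf a) (Finset.sum_nonneg fun i _ => hf i) hc).trans
      (by gcongr)

theorem add_inf_eq_zero {a b d : G} (ha : 0 ≤ a) (hb : 0 ≤ b) (hd : 0 ≤ d)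
    (had : a ⊓ d = 0) (hbd : b ⊓ d = 0) : (a + b) ⊓ d = 0 := by
  refine le_antisymm ?_ (le_inf (add_nonneg ha hb) hd)
  rw [inf_comm]
  refine (inf_add_le_inf_add_inf ha hb hd).trans ?_
  rw [inf_comm d a, inf_comm d b, had, hbd, add_zero]

end LatticeOrderedGroup

theorem mulProd_one {M : Type*} [Mul M] [Zero M] (φ : Fin 1 → M) : mulProd 1 φ = φ 0 := by
  simp [mulProd]

theorem mulProd_succ {M : Type*} [Mul M] [Zero M] (k : ℕ) (φ : Fin (k + 2) → M) :
    mulProd (k + 2) φ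
      = mulProd (k + 1) (fun i => φ i.castSucc) * φ (Fin.last (k + 1)) := by
  simp only [mulProd, Fin.foldl_succ_last]
  rfl

theorem mpow_one {M : Type*} [Mul M] [Zero M] (a : M) : mpow a 1 = a :=
  mulProd_one _

theorem mpow_succ {M : Type*} [Mul M] [Zero M] (a : M) (k : ℕ) :
    mpow a (k + 2) = mpow a (k + 1) * a :=
  mulProd_succ k _

namespace IsLAlgebra

variable [Mul A]

theorem isOrderedAddMonoid_s7 (hA : IsLAlgebra A) : IsOrderedAddMonoid A where
  add_le_add_left a b h c := by
    rw [add_comm a c, add_comm b c]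
    exact hA.add_le_add_left a b h c

theorem mul_sub_s7 (hA : IsLAlgebra A) (a b c : A) : a * (b - c) = a * b - a * c := by
  rw [eq_sub_iff_add_eq, ← hA.left_distrib, sub_add_cancel]

theorem sub_mul_s7 (hA : IsLAlgebra A) (a b c : A) : (a - b) * c = a * c - b * c := by
  rw [eq_sub_iff_add_eq, ← hA.right_distrib, sub_add_cancel]

theorem smul_nonneg (hA : IsLAlgebra A) {r : ℝ} {a : A} (hr : 0 ≤ r) (ha : 0 ≤ a) :
    0 ≤ r • a := by
  simpa using hA.smul_le_smul r 0 a hr ha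

theorem smul_mpow (hA : IsLAlgebra A) (r : ℝ) (a : A) (k : ℕ) :
    mpow (r • a) (k + 1) = r ^ (k + 1) • mpow a (k + 1) := by
  induction k with
  | zero => simp [mpow_one]
  | succ k ih =>
    rw [mpow_succ, mpow_succ, ih, hA.smul_mul, hA.mul_smul, smul_smul, ← pow_succ]

theorem mpow_nonneg (hA : IsLAlgebra A) {a : A} (ha : 0 ≤ a) (k : ℕ) :
    0 ≤ mpow a (k + 1) := by
  induction k with
  | zero => rwa [mpow_one]
  | succ k ih => rw [mpow_succ]; exact hA.mul_nonneg _ _ ih ha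

variable [IsOrderedAddMonoid A]

theorem mul_le_mul (hA : IsLAlgebra A) {a b c d : A} (hab : a ≤ b) (hcd : c ≤ d)
    (hb : 0 ≤ b) (hc : 0 ≤ c) : a * c ≤ b * d := by
  have h₁ := hA.mul_nonneg _ _ (sub_nonneg.2 hab) hc
  have h₂ := hA.mul_nonneg _ _ hb (sub_nonneg.2 hcd)
  rw [hA.sub_mul_s7, sub_nonneg] at h₁
  rw [hA.mul_sub_s7, sub_nonneg] at h₂
  exact h₁.trans h₂

theorem mul_le_abs_mul_abs (hA : IsLAlgebra A) (a b : A) : a * b ≤ |a| * |b| := by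
  have h₁ := hA.mul_nonneg (|a| - a) (|b| + b)
    (sub_nonneg.2 (le_abs_self a)) (neg_le_iff_add_nonneg.1 (neg_le_abs b))
  have h₂ := hA.mul_nonneg (|a| + a) (|b| - b)
    (neg_le_iff_add_nonneg.1 (neg_le_abs a)) (sub_nonneg.2 (le_abs_self b))
  have h := hA.smul_nonneg (r := 1 / 2) (by norm_num) (add_nonneg h₁ h₂)
  rw [← sub_nonneg]
  convert h using 1
  simp only [hA.sub_mul_s7, hA.mul_sub_s7, hA.left_distrib, hA.right_distrib]
  module

theorem abs_mul_le_s7 (hA : IsLAlgebra A) (a b : A) : |a * b| ≤ |a| * |b| := by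
  refine abs_le'.2 ⟨hA.mul_le_abs_mul_abs a b, ?_⟩
  have h := hA.mul_le_abs_mul_abs (-a) b
  rwa [abs_neg, ← zero_sub a, hA.sub_mul_s7, ← sub_self (0 : A), hA.sub_mul_s7, sub_self,
    zero_sub] at h

theorem abs_mulProd_le_mpow (hA : IsLAlgebra A) {w : A} (k : ℕ) (φ : Fin (k + 1) → A)
    (h : ∀ i, |φ i| ≤ w) : |mulProd (k + 1) φ| ≤ mpow w (k + 1) := by
  induction k with
  | zero => rw [mulProd_one, mpow_one]; exact h 0
  | succ k ih =>
    rw [mulProd_succ, mpow_succ]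
    exact (hA.abs_mul_le_s7 _ _).trans (hA.mul_le_mul (ih _ fun i => h _) (h _)
      (hA.mpow_nonneg ((abs_nonneg _).trans (h 0)) k) (abs_nonneg _))

theorem mpow_le_mpow (hA : IsLAlgebra A) {a b : A} (ha : 0 ≤ a) (hab : a ≤ b) (k : ℕ) :
    mpow a (k + 1) ≤ mpow b (k + 1) :=
  (le_abs_self _).trans (hA.abs_mulProd_le_mpow k _ fun _ => (abs_of_nonneg ha).trans_le hab)

theorem nsmul_mpow_le (hA : IsLAlgebra A) {a : A} (ha : 0 ≤ a) (n k : ℕ) :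
    n • mpow a (k + 1) ≤ mpow (n • a) (k + 1) := by
  rw [← Nat.cast_smul_eq_nsmul ℝ n a, hA.smul_mpow, ← Nat.cast_pow, Nat.cast_smul_eq_nsmul]
  exact nsmul_le_nsmul_left (hA.mpow_nonneg ha k) (Nat.le_self_pow k.succ_ne_zero n)

/-- Under weak factorization every element is dominated by a power of any prescribed exponent. -/
theorem exists_le_mpow (hA : IsLAlgebra A) (hwf : WeakFactorization A) (k : ℕ) (x : A) :
    ∃ y : A, 0 ≤ y ∧ x ≤ mpow y (k + 1) := by
  induction k generalizing x with
  | zero => exact ⟨|x|, abs_nonneg x, by rw [mpow_one]; exact le_abs_self x⟩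
  | succ k ih =>
    obtain ⟨b, c, hx⟩ := hwf x
    obtain ⟨y, hy, hby⟩ := ih |b|
    refine ⟨y ⊔ |c|, le_sup_of_le_left hy, ?_⟩
    rw [mpow_succ]
    exact (hx.trans (hA.mul_le_abs_mul_abs b c)).trans
      (hA.mul_le_mul (hby.trans (hA.mpow_le_mpow hy le_sup_left k)) le_sup_right
        (hA.mpow_nonneg (le_sup_of_le_left hy) k) (abs_nonneg c))

theorem exists_forall_inf_nsmul_sum_le (hA : IsLAlgebra A) {ι : Type*} [Fintype ι]
    {φ u : ι → A} {w : A} (hm : ∀ i, IsMajorant (u i) (φ i)) (huw : ∀ i, u i ≤ w)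
    (hw : 0 ≤ w) (x : A) :
    ∃ c : ℝ, 0 < c ∧ ∀ n : ℕ, |x| ⊓ n • ∑ i, |φ i| ≤ c • w := by
  choose c hc hcn using fun i => (hm i).2 x
  refine ⟨∑ i, c i + 1, add_pos_of_nonneg_of_pos
    (Finset.sum_nonneg fun i _ => (hc i).le) one_pos, fun n => ?_⟩
  rw [Finset.smul_sum]
  refine (inf_sum_le_sum_inf _ (fun i => nsmul_nonneg (abs_nonneg _) n) (abs_nonneg x)).trans ?_
  refine (Finset.sum_le_sum fun i _ =>
    (hcn i n).trans (hA.smul_le_smul _ _ _ (hc i).le (huw i))).trans ?_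
  rw [← Finset.sum_smul, add_smul, one_smul]
  exact le_add_of_nonneg_right hw

end IsLAlgebra

namespace IsFAlgebra

variable [Mul A] [IsOrderedAddMonoid A]

theorem mpow_sub_mpow_inf_eq_zero (hA : IsFAlgebra A) {m a d : A} (hm : 0 ≤ m) (hma : m ≤ a)
    (hd : 0 ≤ d) (h : (a - m) ⊓ d = 0) (k : ℕ) :
    (mpow a (k + 1) - mpow m (k + 1)) ⊓ d = 0 := by
  induction k with
  | zero => rwa [mpow_one, mpow_one]
  | succ k ih =>
    have hpow : 0 ≤ mpow a (k + 1) - mpow m (k + 1) :=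
      sub_nonneg.2 (hA.mpow_le_mpow hm hma k)
    have hsplit : mpow a (k + 2) - mpow m (k + 2)
        = (mpow a (k + 1) - mpow m (k + 1)) * a + mpow m (k + 1) * (a - m) := by
      rw [mpow_succ, mpow_succ, hA.sub_mul_s7, hA.mul_sub_s7]
      abel
    rw [hsplit]
    exact add_inf_eq_zero (hA.mul_nonneg _ _ hpow (hm.trans hma))
      (hA.mul_nonneg _ _ (hA.mpow_nonneg hm k) (sub_nonneg.2 hma)) hd
      (hA.f_prop _ _ a ih (hm.trans hma)).1 (hA.f_prop _ _ _ h (hA.mpow_nonneg hm k)).2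

theorem mpow_inf (hA : IsFAlgebra A) {a b : A} (ha : 0 ≤ a) (hb : 0 ≤ b) (k : ℕ) :
    mpow (a ⊓ b) (k + 1) = mpow a (k + 1) ⊓ mpow b (k + 1) := by
  have hm : 0 ≤ a ⊓ b := le_inf ha hb
  have h : (a - a ⊓ b) ⊓ (b - a ⊓ b) = 0 := by rw [← inf_sub, sub_self]
  have h₁ := hA.mpow_sub_mpow_inf_eq_zero hm inf_le_left (sub_nonneg.2 inf_le_right) h k
  rw [inf_comm] at h₁
  have h₂ := hA.mpow_sub_mpow_inf_eq_zero hm inf_le_right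
    (sub_nonneg.2 (hA.mpow_le_mpow hm inf_le_left k)) h₁ k
  rw [← inf_sub, sub_eq_zero] at h₂
  rw [← h₂, inf_comm]

theorem isMajorant_mpow_mulProd (hA : IsFAlgebra A) (hwf : WeakFactorization A) (k : ℕ)
    {φ u : Fin (k + 1) → A} {w : A} (hm : ∀ i, IsMajorant (u i) (φ i)) (huw : ∀ i, u i ≤ w) :
    IsMajorant (mpow w (k + 1)) (mulProd (k + 1) φ) := by
  have hw : 0 ≤ w := (hm 0).1.trans (huw 0)
  refine ⟨hA.mpow_nonneg hw k, fun x => ?_⟩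
  obtain ⟨y, hy, hxy⟩ := hA.exists_le_mpow hwf k |x|
  obtain ⟨c, hc, hcn⟩ := hA.exists_forall_inf_nsmul_sum_le hm huw hw y
  rw [abs_of_nonneg hy] at hcn
  refine ⟨c ^ (k + 1), pow_pos hc _, fun n => ?_⟩
  have hs : 0 ≤ ∑ i, |φ i| := Finset.sum_nonneg fun i _ => abs_nonneg (φ i)
  have hprod : |mulProd (k + 1) φ| ≤ mpow (∑ i, |φ i|) (k + 1) :=
    hA.abs_mulProd_le_mpow k φ fun i =>
      Finset.single_le_sum (f := fun i => |φ i|) (fun j _ => abs_nonneg (φ j)) (Finset.mem_univ i)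
  calc |x| ⊓ n • |mulProd (k + 1) φ|
      ≤ mpow y (k + 1) ⊓ mpow (n • ∑ i, |φ i|) (k + 1) :=
        inf_le_inf hxy ((nsmul_le_nsmul_right hprod n).trans (hA.nsmul_mpow_le hs n k))
    _ = mpow (y ⊓ n • ∑ i, |φ i|) (k + 1) := (hA.mpow_inf hy (nsmul_nonneg hs n) k).symm
    _ ≤ mpow (c • w) (k + 1) :=
        hA.mpow_le_mpow (le_inf hy (nsmul_nonneg hs n)) (hcn n) k
    _ = c ^ (k + 1) • mpow w (k + 1) := hA.smul_mpow c w k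

theorem isFiniteElt_mpow (hA : IsFAlgebra A) (hwf : WeakFactorization A) {w : A}
    (hw : IsFiniteElt w) (k : ℕ) : IsFiniteElt (mpow w (k + 1)) := by
  obtain ⟨v, hv⟩ := hw
  exact ⟨_, hA.isMajorant_mpow_mulProd hwf k (fun _ => hv) fun _ => le_rfl⟩

end IsFAlgebra

theorem IsLAlgebra.isFiniteElt_of_abs_le_sum [Mul A] [IsOrderedAddMonoid A] (hA : IsLAlgebra A)
    {ι : Type*} [Fintype ι] {φ : ι → A} {w : A} (hφ : ∀ i, IsFiniteElt (φ i))
    (hw : |w| ≤ ∑ i, |φ i|) : IsFiniteElt w := by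
  choose v hv using hφ
  have hv₀ : 0 ≤ ∑ i, v i := Finset.sum_nonneg fun i _ => (hv i).1
  refine ⟨∑ i, v i, hv₀, fun x => ?_⟩
  obtain ⟨c, hc, hcn⟩ := hA.exists_forall_inf_nsmul_sum_le hv
    (fun i => Finset.single_le_sum (fun j _ => (hv j).1) (Finset.mem_univ i)) hv₀ x
  exact ⟨c, hc, fun n => (inf_le_inf_left _ (nsmul_le_nsmul_right hw n)).trans (hcn n)⟩

theorem IsLAlgebra.isFiniteElt_sup' [Mul A] [IsOrderedAddMonoid A] (hA : IsLAlgebra A)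
    {ι : Type*} [Fintype ι] (s : (Finset.univ : Finset ι).Nonempty) {v : ι → A}
    (hv₀ : ∀ i, 0 ≤ v i) (hv : ∀ i, IsFiniteElt (v i)) :
    IsFiniteElt (Finset.univ.sup' s v) := by
  refine hA.isFiniteElt_of_abs_le_sum hv ?_
  obtain ⟨j, hj⟩ := id s
  rw [abs_of_nonneg ((hv₀ j).trans (Finset.le_sup' v hj))]
  exact Finset.sup'_le s v fun i hi => (le_abs_self _).trans
    (Finset.single_le_sum (f := fun i => |v i|) (fun l _ => abs_nonneg (v l)) hi)

/-- In a uniformly complete f-algebra with the weak factorization property, the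
product of finite (resp. totally finite) elements `φ₁, …, φ_p` with majorants `u₁, …, u_p` is
finite (resp. totally finite) with majorant `(u₁ ⊔ … ⊔ u_p)^p`; in particular `Φ₁(𝒜)` and
`Φ₂(𝒜)` are closed under multiplication. -/
theorem stmt7 {A : Type*} [Lattice A] [AddCommGroup A] [Module ℝ A] [Mul A]
    (hA : IsFAlgebra A) (huc : UniformlyComplete A) (hwf : WeakFactorization A)
    (p : ℕ) (hp : 2 ≤ p) (φ u : Fin p → A) (hm : ∀ i, IsMajorant (u i) (φ i)) :
    (IsMajorant (mpow (Finset.univ.sup' ⟨⟨0, by omega⟩, Finset.mem_univ _⟩ u) p)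
        (mulProd p φ) ∧
      ((∀ i, IsFiniteElt (u i)) →
        IsFiniteElt (mpow (Finset.univ.sup' ⟨⟨0, by omega⟩, Finset.mem_univ _⟩ u) p))) ∧
    (∀ a b : A, IsFiniteElt a → IsFiniteElt b → IsFiniteElt (a * b)) ∧
    (∀ a b : A, IsTotallyFiniteElt a → IsTotallyFiniteElt b → IsTotallyFiniteElt (a * b)) := by
  have := hA.isOrderedAddMonoid_s7
  have hpair : ∀ a b u v : A, IsMajorant u a → IsMajorant v b →
      IsMajorant (mpow (u ⊔ v) 2) (a * b) := by
    intro a b u v ha hb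
    have h := hA.isMajorant_mpow_mulProd hwf 1 (φ := ![a, b]) (u := ![u, v]) (w := u ⊔ v)
      (by simp [Fin.forall_fin_two, ha, hb]) (by simp [Fin.forall_fin_two])
    rwa [mulProd_succ, mulProd_one] at h
  obtain ⟨k, rfl⟩ : ∃ k, p = k + 1 := ⟨p - 1, by omega⟩
  refine ⟨⟨hA.isMajorant_mpow_mulProd hwf k hm fun i => Finset.le_sup' u (Finset.mem_univ i),
    fun hu => hA.isFiniteElt_mpow hwf (hA.isFiniteElt_sup' _ (fun i => (hm i).1) hu) k⟩, ?_, ?_⟩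
  · rintro a b ⟨u, hu⟩ ⟨v, hv⟩
    exact ⟨_, hpair a b u v hu hv⟩
  · rintro a b ⟨u, hu, huf⟩ ⟨v, hv, hvf⟩
    refine ⟨_, hpair a b u v hu hv, hA.isFiniteElt_mpow hwf ?_ 1⟩
    refine hA.isFiniteElt_of_abs_le_sum (φ := ![u, v])
      (by simp [Fin.forall_fin_two, huf, hvf]) ?_
    rw [abs_of_nonneg (le_sup_of_le_left hu.1)]
    simp [Fin.sum_univ_two, abs_of_nonneg hu.1, abs_of_nonneg hv.1, hu.1, hv.1]

end FiniteElementsPaper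
end
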